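/- Let K be a finite index set, q a natural number with q ≥ 1, and P ≥ 0 a real number. Suppose for each k ∈ K we have reals p_k, x_k, x₀_k with 0 ≤ x_k ≤ 1, 0 ≤ x₀_k ≤ 1, and p_k ≤ (x₀_k^q + q·x₀_k^(q−1)·(x_k − x₀_k))·P. If Σ_{k∈K} x_k ≤ 1, then Σ_{k∈K} p_k ≤ P. -/

import Mathlib

/-- The tangent line of `t ↦ t ^ (n + 1)` at `a ≥ 0` lies below its graph on `[0, ∞)`. -/
theorem pow_succ_tangent_le {a x : ℝ} (ha : 0 ≤ a) (hx : 0 ≤ x) (n : ℕ) :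
    a ^ (n + 1) + ((n + 1 : ℕ) : ℝ) * a ^ n * (x - a) ≤ x ^ (n + 1) := by
  induction n with
  | zero => simp
  | succ n ih =>
    have hmul := mul_le_mul_of_nonneg_left ih hx
    have hgap : 0 ≤ ((n : ℝ) + 1) * a ^ n * (x - a) ^ 2 := by positivity
    push_cast at hmul ⊢
    rw [pow_succ' x (n + 1)]
    refine le_trans ?_ hmul
    linear_combination hgap

/-- The linearized per-subcarrier power constraints, together with the relaxed
allocation variables summing to at most one, imply the total power constraint. -/
theorem stmt_8 {ι : Type*} (K : Finset ι) (q : ℕ) (hq : 1 ≤ q)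
    (P : ℝ) (hP : 0 ≤ P) (p x x₀ : ι → ℝ)
    (hx : ∀ k ∈ K, 0 ≤ x k ∧ x k ≤ 1)
    (hx₀ : ∀ k ∈ K, 0 ≤ x₀ k ∧ x₀ k ≤ 1)
    (hp : ∀ k ∈ K, p k ≤ (x₀ k ^ q + (q : ℝ) * x₀ k ^ (q - 1) * (x k - x₀ k)) * P)
    (hsum : ∑ k ∈ K, x k ≤ 1) :
    ∑ k ∈ K, p k ≤ P := by
  have hpx : ∀ k ∈ K, p k ≤ x k * P := by
    intro k hk
    obtain ⟨hx_nonneg, hx_le⟩ := hx k hk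
    refine (hp k hk).trans (mul_le_mul_of_nonneg_right ?_ hP)
    obtain ⟨n, rfl⟩ := Nat.exists_eq_add_of_le' hq
    exact (pow_succ_tangent_le (hx₀ k hk).1 hx_nonneg n).trans
      (pow_le_of_le_one hx_nonneg hx_le n.succ_ne_zero)
  calc ∑ k ∈ K, p k ≤ ∑ k ∈ K, x k * P := Finset.sum_le_sum hpx
    _ = (∑ k ∈ K, x k) * P := (Finset.sum_mul K x P).symm
    _ ≤ P := mul_le_of_le_one_left hP hsum
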